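/- Let n be odd and let L be a reduced Latin square of order n with parity type (k,m). If k ≡ m (mod 2), then n² · |{L′ ∈ 𝓘′_n(L) : L′ is even}| = (km + (n−k)(n−m)) · |𝓘′_n(L)|, and if k ≢ m (mod 2), then n² · |{L′ ∈ 𝓘′_n(L) : L′ is even}| = (k(n−m) + m(n−k)) · |𝓘′_n(L)|, where 𝓘′_n(L) is the set of reduced Latin squares isotopic to L. -/

import Mathlib

open Equiv Finset

/-- A Latin square of order `n`: an `n × n` array of symbols from `Fin n`
such that every symbol occurs exactly once in each row and each column. -/
structure LatinSquare (n : ℕ) where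
  entry : Fin n → Fin n → Fin n
  row_bij : ∀ r : Fin n, Function.Bijective fun c => entry r c
  col_bij : ∀ c : Fin n, Function.Bijective fun r => entry r c

namespace LatinSquare

variable {n : ℕ}

/-- Row `r` of `L` as a permutation: `rowPerm L r i = j ↔ L r j = i`. -/
noncomputable def rowPerm (L : LatinSquare n) (r : Fin n) : Equiv.Perm (Fin n) :=
  (Equiv.ofBijective _ (L.row_bij r)).symm

/-- Column `c` of `L` as a permutation: `colPerm L c i = j ↔ L j c = i`. -/
noncomputable def colPerm (L : LatinSquare n) (c : Fin n) : Equiv.Perm (Fin n) :=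
  (Equiv.ofBijective _ (L.col_bij c)).symm

/-- The isotopism `(α, β, γ)` applied to `L`: `α` permutes rows, `β` permutes
columns, `γ` permutes symbols. -/
def isotope (α β γ : Equiv.Perm (Fin n)) (L : LatinSquare n) : LatinSquare n where
  entry r c := γ (L.entry (α⁻¹ r) (β⁻¹ c))
  row_bij r := by
    have h : (fun c => γ (L.entry (α⁻¹ r) (β⁻¹ c))) =
        (γ : Fin n → Fin n) ∘ (fun c => L.entry (α⁻¹ r) c) ∘ (β⁻¹ : Equiv.Perm (Fin n)) := rfl
    rw [h]
    exact (γ.bijective.comp (L.row_bij _)).comp (β⁻¹).bijective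
  col_bij c := by
    have h : (fun r => γ (L.entry (α⁻¹ r) (β⁻¹ c))) =
        (γ : Fin n → Fin n) ∘ (fun r => L.entry r (β⁻¹ c)) ∘ (α⁻¹ : Equiv.Perm (Fin n)) := rfl
    rw [h]
    exact (γ.bijective.comp (L.col_bij _)).comp (α⁻¹).bijective

/-- `L'` is isotopic to `L` if some isotopism transforms `L` into `L'`. -/
def Isotopic (L L' : LatinSquare n) : Prop :=
  ∃ α β γ : Equiv.Perm (Fin n), isotope α β γ L = L'

/-- A Latin square is reduced if its first row and first column are the identity. -/
def Reduced [NeZero n] (L : LatinSquare n) : Prop :=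
  L.rowPerm 0 = 1 ∧ L.colPerm 0 = 1

/-- The parity of `L`: the product of the signs of all rows and all columns. -/
noncomputable def par (L : LatinSquare n) : ℤˣ :=
  (∏ r : Fin n, Equiv.Perm.sign (L.rowPerm r)) * ∏ c : Fin n, Equiv.Perm.sign (L.colPerm c)

/-- The parity type `(k, m)` of `L`: `k` is the minimum of the number of even rows
and the number of odd rows, `m` is the analogous quantity for columns. -/
noncomputable def parityType (L : LatinSquare n) : ℕ × ℕ :=
  (min (univ.filter fun r => Equiv.Perm.sign (L.rowPerm r) = 1).card
      (univ.filter fun r => Equiv.Perm.sign (L.rowPerm r) = -1).card,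
   min (univ.filter fun c => Equiv.Perm.sign (L.colPerm c) = 1).card
      (univ.filter fun c => Equiv.Perm.sign (L.colPerm c) = -1).card)

end LatinSquare

/-- The number of autotopisms of `L`, i.e. the order of the autotopy group `𝔄(L)`. -/
noncomputable def autotopyCard {n : ℕ} (L : LatinSquare n) : ℕ :=
  Nat.card {Θ : Equiv.Perm (Fin n) × Equiv.Perm (Fin n) × Equiv.Perm (Fin n) //
    LatinSquare.isotope Θ.1 Θ.2.1 Θ.2.2 L = L}

namespace LatinSquare

variable {n : ℕ}

theorem ls_ext {L L' : LatinSquare n} (h : ∀ r c, L.entry r c = L'.entry r c) : L = L' := by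
  cases L; cases L'
  congr
  funext r c
  exact h r c

theorem rowPerm_inv_apply (L : LatinSquare n) (r c : Fin n) :
    (L.rowPerm r)⁻¹ c = L.entry r c := rfl

theorem colPerm_inv_apply (L : LatinSquare n) (r c : Fin n) :
    (L.colPerm c)⁻¹ r = L.entry r c := rfl

theorem isotope_mul (a b c a' b' c' : Equiv.Perm (Fin n)) (L : LatinSquare n) :
    isotope a b c (isotope a' b' c' L) = isotope (a * a') (b * b') (c * c') L := by
  apply ls_ext
  intro r s
  simp [isotope]

theorem isotope_one (L : LatinSquare n) : isotope 1 1 1 L = L := by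
  apply ls_ext
  intro r s
  simp [isotope]

theorem rowPerm_isotope (a b c : Equiv.Perm (Fin n)) (L : LatinSquare n) (r : Fin n) :
    (isotope a b c L).rowPerm r = b * L.rowPerm (a⁻¹ r) * c⁻¹ := by
  rw [← inv_inj]
  ext x
  rw [rowPerm_inv_apply]
  simp [mul_inv_rev, isotope, rowPerm_inv_apply, Perm.mul_apply]

theorem colPerm_isotope (a b c : Equiv.Perm (Fin n)) (L : LatinSquare n) (r : Fin n) :
    (isotope a b c L).colPerm r = a * L.colPerm (b⁻¹ r) * c⁻¹ := by
  rw [← inv_inj]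
  ext x
  rw [colPerm_inv_apply]
  simp [mul_inv_rev, isotope, colPerm_inv_apply, Perm.mul_apply]

theorem reduced_isotope_iff [NeZero n] (a b c : Equiv.Perm (Fin n)) (L : LatinSquare n) :
    (isotope a b c L).Reduced ↔
      b = c * (L.rowPerm (a⁻¹ 0))⁻¹ ∧ a = c * (L.colPerm (b⁻¹ 0))⁻¹ := by
  unfold Reduced
  rw [rowPerm_isotope, colPerm_isotope, mul_inv_eq_one, mul_inv_eq_one,
    eq_mul_inv_iff_mul_eq, eq_mul_inv_iff_mul_eq]

abbrev Tri (n : ℕ) := Equiv.Perm (Fin n) × Equiv.Perm (Fin n) × Equiv.Perm (Fin n)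

def act (t : Tri n) (L : LatinSquare n) : LatinSquare n := isotope t.1 t.2.1 t.2.2 L

theorem act_mul (s t : Tri n) (L : LatinSquare n) : act s (act t L) = act (s * t) L :=
  isotope_mul _ _ _ _ _ _ L

theorem act_one (L : LatinSquare n) : act 1 L = L := isotope_one L

noncomputable def fibreEquiv (L L' : LatinSquare n) (h : ∃ t, act t L = L') :
    {t : Tri n // act t L = L'} ≃ {t : Tri n // act t L = L} where
  toFun t := ⟨h.choose⁻¹ * t.1, by
    have h1 : act h.choose⁻¹ (act h.choose L) = L := by
      rw [act_mul, inv_mul_cancel, act_one]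
    rw [← act_mul, t.2]
    exact (congrArg (act h.choose⁻¹) h.choose_spec.symm).trans h1⟩
  invFun t := ⟨h.choose * t.1, by rw [← act_mul, t.2, h.choose_spec]⟩
  left_inv t := by simp
  right_inv t := by simp

theorem card_fibre (L : LatinSquare n) (Q : LatinSquare n → Prop) :
    Nat.card {t : Tri n // Q (act t L)} =
      Nat.card {L' : LatinSquare n // (∃ t, act t L = L') ∧ Q L'} *
        Nat.card {t : Tri n // act t L = L} := by
  rw [← Nat.card_prod]
  refine Nat.card_congr (Equiv.trans (β := Σ L' : {L' : LatinSquare n // (∃ t, act t L = L') ∧ Q L'},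
    {t : Tri n // act t L = L'.1}) ?_ ?_)
  · exact
      { toFun := fun t => ⟨⟨act t.1 L, ⟨t.1, rfl⟩, t.2⟩, ⟨t.1, rfl⟩⟩
        invFun := fun x => ⟨x.2.1, by rw [x.2.2]; exact x.1.2.2⟩
        left_inv := fun t => rfl
        right_inv := by 
          rintro ⟨⟨L', h, hq⟩, ⟨t, ht⟩⟩
          dsimp only at ht
          subst ht
          rfl }
  · exact (Equiv.sigmaCongrRight fun L' : {L' : LatinSquare n // (∃ t, act t L = L') ∧ Q L'} => fibreEquiv L L'.1 L'.2.1).trans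
      (Equiv.sigmaEquivProd _ _)

noncomputable def paramEquiv [NeZero n] (L : LatinSquare n) (P : Fin n × Fin n → Prop) :
    {t : Tri n // (act t L).Reduced ∧ P (t.1⁻¹ 0, t.2.1⁻¹ 0)} ≃
      {p : Fin n × Fin n // P p} × {c : Equiv.Perm (Fin n) // c 0 = 0} where
  toFun t := ⟨⟨(t.1.1⁻¹ 0, t.1.2.1⁻¹ 0), t.2.2⟩,
    ⟨t.1.2.2 * swap 0 (L.entry (t.1.1⁻¹ 0) (t.1.2.1⁻¹ 0)), by
      obtain ⟨⟨a, b, c⟩, h, hp⟩ := t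
      have h1 := ((reduced_isotope_iff a b c L).1 h).1
      have h2 := congrArg (fun f : Equiv.Perm (Fin n) => f (b⁻¹ 0)) h1
      simp only [Perm.mul_apply, rowPerm_inv_apply] at h2
      rw [show b (b⁻¹ 0) = 0 from b.apply_symm_apply 0] at h2
      simp only [Perm.mul_apply, swap_apply_left]
      exact h2.symm⟩⟩
  invFun x :=
    let c := x.2.1 * swap 0 (L.entry x.1.1.1 x.1.1.2)
    have hc : c (L.entry x.1.1.1 x.1.1.2) = 0 := by
      simp only [c, Perm.mul_apply, swap_apply_right]; exact x.2.2
    have ha : (c * (L.colPerm x.1.1.2)⁻¹)⁻¹ 0 = x.1.1.1 := by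
      rw [Perm.inv_eq_iff_eq, Perm.mul_apply, colPerm_inv_apply, hc]
    have hb : (c * (L.rowPerm x.1.1.1)⁻¹)⁻¹ 0 = x.1.1.2 := by
      rw [Perm.inv_eq_iff_eq, Perm.mul_apply, rowPerm_inv_apply, hc]
    ⟨(c * (L.colPerm x.1.1.2)⁻¹, c * (L.rowPerm x.1.1.1)⁻¹, c), by
      refine ⟨(reduced_isotope_iff _ _ _ L).2 ?_, ?_⟩
      · dsimp only
        rw [ha, hb]; exact ⟨rfl, rfl⟩
      · dsimp only
        rw [ha, hb]; exact x.1.2⟩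
  left_inv t := by
    obtain ⟨⟨a, b, c⟩, h, hp⟩ := t
    have h1 := (reduced_isotope_iff a b c L).1 h
    apply Subtype.ext
    dsimp only
    rw [show c * swap 0 (L.entry (a⁻¹ 0) (b⁻¹ 0)) * swap 0 (L.entry (a⁻¹ 0) (b⁻¹ 0)) = c by
      rw [mul_assoc, swap_mul_self, mul_one]]
    exact Prod.ext h1.2.symm (Prod.ext h1.1.symm rfl)
  right_inv x := by
    obtain ⟨⟨⟨r, s⟩, hp⟩, ⟨c, hc0⟩⟩ := x
    have hc : (c * swap 0 (L.entry r s)) (L.entry r s) = 0 := by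
      simp only [Perm.mul_apply, swap_apply_right]; exact hc0
    have ha : ((c * swap 0 (L.entry r s)) * (L.colPerm s)⁻¹)⁻¹ 0 = r := by
      rw [Perm.inv_eq_iff_eq, Perm.mul_apply, colPerm_inv_apply, hc]
    have hb : ((c * swap 0 (L.entry r s)) * (L.rowPerm r)⁻¹)⁻¹ 0 = s := by
      rw [Perm.inv_eq_iff_eq, Perm.mul_apply, rowPerm_inv_apply, hc]
    refine Prod.ext (Subtype.ext (Prod.ext ha hb)) (Subtype.ext ?_)
    dsimp only
    rw [ha, hb, mul_assoc, swap_mul_self, mul_one]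

theorem par_isotope [NeZero n] (hn : Odd n) (a b c : Equiv.Perm (Fin n)) (L : LatinSquare n)
    (h : (isotope a b c L).Reduced) :
    (isotope a b c L).par =
      L.par * (Equiv.Perm.sign (L.rowPerm (a⁻¹ 0)) * Equiv.Perm.sign (L.colPerm (b⁻¹ 0))) := by
  obtain ⟨hb, ha⟩ := (reduced_isotope_iff a b c L).1 h
  have sb := congrArg Equiv.Perm.sign hb
  have sa := congrArg Equiv.Perm.sign ha
  simp only [map_mul, Perm.sign_inv] at sa sb
  have hpow : ∀ u : ℤˣ, u ^ n = u := fun u => by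
    rcases Int.units_eq_one_or u with rfl | rfl
    · simp
    · exact hn.neg_one_pow
  have hR : ∏ r, Equiv.Perm.sign (L.rowPerm (a⁻¹ r)) = ∏ r, Equiv.Perm.sign (L.rowPerm r) :=
    Equiv.prod_comp (a⁻¹) (fun r => Equiv.Perm.sign (L.rowPerm r))
  have hC : ∏ r, Equiv.Perm.sign (L.colPerm (b⁻¹ r)) = ∏ r, Equiv.Perm.sign (L.colPerm r) :=
    Equiv.prod_comp (b⁻¹) (fun r => Equiv.Perm.sign (L.colPerm r))
  unfold par
  simp only [rowPerm_isotope, colPerm_isotope, map_mul, Perm.sign_inv, Finset.prod_mul_distrib,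
    Finset.prod_const, Finset.card_univ, Fintype.card_fin, hpow, hR, hC]
  generalize (∏ r, Equiv.Perm.sign (L.rowPerm r)) = R
  generalize (∏ r, Equiv.Perm.sign (L.colPerm r)) = C
  generalize Equiv.Perm.sign (L.rowPerm (a⁻¹ 0)) = s at *
  generalize Equiv.Perm.sign (L.colPerm (b⁻¹ 0)) = t at *
  rw [sa, sb]
  generalize Equiv.Perm.sign c = g
  rcases Int.units_eq_one_or g with rfl | rfl <;> simp <;> ac_rfl

theorem card_key [NeZero n] (L : LatinSquare n) (Q : LatinSquare n → Prop)
    (P : Fin n × Fin n → Prop)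
    (hQP : ∀ t : Tri n, (act t L).Reduced → (Q (act t L) ↔ P (t.1⁻¹ 0, t.2.1⁻¹ 0))) :
    Nat.card {L' : LatinSquare n // L'.Reduced ∧ Isotopic L L' ∧ Q L'} *
        Nat.card {t : Tri n // act t L = L} =
      Nat.card {p : Fin n × Fin n // P p} * Nat.card {c : Equiv.Perm (Fin n) // c 0 = 0} := by
  have h1 := card_fibre L (fun L' => L'.Reduced ∧ Q L')
  have h2 : Nat.card {L' : LatinSquare n // L'.Reduced ∧ Isotopic L L' ∧ Q L'} =
      Nat.card {L' : LatinSquare n // (∃ t, act t L = L') ∧ L'.Reduced ∧ Q L'} := by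
    refine Nat.card_congr (Equiv.subtypeEquivRight fun L' => ?_)
    have : Isotopic L L' ↔ ∃ t, act t L = L' := by
      simp [Isotopic, act, Prod.exists]
    rw [this]; tauto
  rw [h2, ← h1, ← Nat.card_prod, ← Nat.card_congr (paramEquiv L P)]
  exact Nat.card_congr (Equiv.subtypeEquivRight fun t =>
    and_congr_right fun h => hQP t h)

theorem prod_sign (f : Fin n → ℤˣ) :
    ∏ r, f r = (-1) ^ (univ.filter fun r => f r = -1).card := by
  have : ∀ r, f r = if f r = -1 then -1 else 1 := fun r => by
    rcases Int.units_eq_one_or (f r) with h | h <;> simp [h]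
  rw [Finset.prod_congr rfl fun r _ => this r, Finset.prod_ite]
  simp

theorem card_sign (f : Fin n → ℤˣ) :
    (univ.filter fun r => f r = 1).card + (univ.filter fun r => f r = -1).card = n := by
  have h := Finset.card_filter_add_card_filter_not (s := (univ : Finset (Fin n))) (fun r => f r = 1)
  have h2 : (univ.filter fun r => f r = -1) = univ.filter fun r => ¬ f r = 1 := by
    apply Finset.filter_congr
    intro r _
    rcases Int.units_eq_one_or (f r) with h | h <;> simp [h]
  rw [h2, h, Finset.card_univ, Fintype.card_fin]

theorem card_pairs (f g : Fin n → ℤˣ) :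
    Nat.card {p : Fin n × Fin n // f p.1 * g p.2 = 1} =
      (univ.filter fun r => f r = 1).card * (univ.filter fun r => g r = 1).card +
      (univ.filter fun r => f r = -1).card * (univ.filter fun r => g r = -1).card := by
  classical
  rw [Nat.card_eq_fintype_card, Fintype.card_subtype, ← Finset.card_product,
    ← Finset.card_product, ← Finset.card_union_of_disjoint]
  · congr 1
    ext ⟨r, c⟩
    rcases Int.units_eq_one_or (f r) with h | h <;>
    rcases Int.units_eq_one_or (g c) with h' | h' <;> simp [h, h']
  · rw [Finset.disjoint_left]
    rintro ⟨r, c⟩ h1 h2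
    simp only [Finset.mem_product, Finset.mem_filter] at h1 h2
    have := h1.1.2.symm.trans h2.1.2
    exact absurd this (by decide)

theorem card_pairs_neg (f g : Fin n → ℤˣ) :
    Nat.card {p : Fin n × Fin n // f p.1 * g p.2 = -1} =
      (univ.filter fun r => f r = 1).card * (univ.filter fun r => g r = -1).card +
      (univ.filter fun r => f r = -1).card * (univ.filter fun r => g r = 1).card := by
  have h := card_pairs f (fun r => - g r)
  simp only [neg_eq_iff_eq_neg, neg_neg, mul_neg] at h
  exact h

end LatinSquare

open LatinSquare in
theorem stmt6_aux {n : ℕ} [NeZero n] (hn : Odd n) (L : LatinSquare n) :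
    n ^ 2 * Nat.card {L' : LatinSquare n //
          L'.Reduced ∧ LatinSquare.Isotopic L L' ∧ L'.par = 1} =
      Nat.card {p : Fin n × Fin n //
        Equiv.Perm.sign (L.rowPerm p.1) * Equiv.Perm.sign (L.colPerm p.2) = L.par} *
          Nat.card {L' : LatinSquare n // L'.Reduced ∧ LatinSquare.Isotopic L L'} := by
  have h1 := card_key L (fun L' => L'.par = 1) (fun p =>
    Equiv.Perm.sign (L.rowPerm p.1) * Equiv.Perm.sign (L.colPerm p.2) = L.par) (by
      intro t ht
      have := par_isotope hn t.1 t.2.1 t.2.2 L ht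
      simp only [act]
      rw [this]
      generalize Equiv.Perm.sign (L.rowPerm _) * Equiv.Perm.sign (L.colPerm _) = u
      generalize L.par = v
      revert u v
      decide)
  have h2 := card_key L (fun _ => True) (fun _ => True) (by simp)
  simp only [and_true] at h2
  have h3 : Nat.card {p : Fin n × Fin n // True} = n ^ 2 := by
    simp [sq]
  rw [h3] at h2
  have hpos : 0 < Nat.card {t : Tri n // act t L = L} := by
    have : Nonempty {t : Tri n // act t L = L} := ⟨⟨1, act_one L⟩⟩
    exact Nat.card_pos
  apply Nat.eq_of_mul_eq_mul_right hpos
  rw [mul_assoc, h1, mul_assoc, h2]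
  ring

/-- for odd `n` and a reduced Latin square `L` of parity type `(k,m)`,
the number of even reduced Latin squares isotopic to `L` is
`(km + (n−k)(n−m))/n² ⬝ |𝓘′_n(L)|` when `k ≡ m (mod 2)`, and
`(k(n−m) + m(n−k))/n² ⬝ |𝓘′_n(L)|` otherwise. -/
theorem stmt6 {n : ℕ} [NeZero n] (hn : Odd n) (L : LatinSquare n) (hL : L.Reduced)
    (k m : ℕ) (hkm : L.parityType = (k, m)) :
    (k % 2 = m % 2 →
      n ^ 2 * Nat.card {L' : LatinSquare n //
          L'.Reduced ∧ LatinSquare.Isotopic L L' ∧ L'.par = 1} =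
        (k * m + (n - k) * (n - m)) *
          Nat.card {L' : LatinSquare n // L'.Reduced ∧ LatinSquare.Isotopic L L'}) ∧
    (k % 2 ≠ m % 2 →
      n ^ 2 * Nat.card {L' : LatinSquare n //
          L'.Reduced ∧ LatinSquare.Isotopic L L' ∧ L'.par = 1} =
        (k * (n - m) + m * (n - k)) *
          Nat.card {L' : LatinSquare n // L'.Reduced ∧ LatinSquare.Isotopic L L'}) := by
  rw [stmt6_aux hn L]
  have hp : L.par = (-1) ^ ((univ.filter fun r => Equiv.Perm.sign (L.rowPerm r) = -1).card +
      (univ.filter fun r => Equiv.Perm.sign (L.colPerm r) = -1).card) := by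
    unfold LatinSquare.par
    rw [LatinSquare.prod_sign, LatinSquare.prod_sign, pow_add]
  have c1 := LatinSquare.card_pairs (fun r => Equiv.Perm.sign (L.rowPerm r))
    (fun r => Equiv.Perm.sign (L.colPerm r))
  have c2 := LatinSquare.card_pairs_neg (fun r => Equiv.Perm.sign (L.rowPerm r))
    (fun r => Equiv.Perm.sign (L.colPerm r))
  have s1 := LatinSquare.card_sign (fun r => Equiv.Perm.sign (L.rowPerm r))
  have s2 := LatinSquare.card_sign (fun r => Equiv.Perm.sign (L.colPerm r))
  unfold LatinSquare.parityType at hkm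
  rw [Prod.mk.injEq] at hkm
  obtain ⟨hk, hm⟩ := hkm
  generalize (univ.filter fun r => Equiv.Perm.sign (L.rowPerm r) = 1).card = e at *
  generalize (univ.filter fun r => Equiv.Perm.sign (L.rowPerm r) = -1).card = o at *
  generalize (univ.filter fun r => Equiv.Perm.sign (L.colPerm r) = 1).card = e' at *
  generalize (univ.filter fun r => Equiv.Perm.sign (L.colPerm r) = -1).card = o' at *
  have hn2 := Nat.odd_iff.1 hn
  have key : ∀ N, N = (if (o + o') % 2 = 0 then e * e' + o * o' else e * o' + o * e') →
      (k % 2 = m % 2 → N = k * m + (n - k) * (n - m)) ∧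
      (k % 2 ≠ m % 2 → N = k * (n - m) + m * (n - k)) := by
    rintro N rfl
    have hk' : (k = e ∧ n - k = o) ∨ (k = o ∧ n - k = e) := by omega
    have hm' : (m = e' ∧ n - m = o') ∨ (m = o' ∧ n - m = e') := by omega
    rcases hk' with ⟨a, b⟩ | ⟨a, b⟩ <;> rcases hm' with ⟨c, d⟩ | ⟨c, d⟩ <;> rw [b, d, a, c] <;>
    refine ⟨fun h => ?_, fun h => ?_⟩ <;> split_ifs with h' <;>
    first
    | (exfalso; omega)
    | ring
  have hN : Nat.card {p : Fin n × Fin n //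
        Equiv.Perm.sign (L.rowPerm p.1) * Equiv.Perm.sign (L.colPerm p.2) = L.par} =
      (if (o + o') % 2 = 0 then e * e' + o * o' else e * o' + o * e') := by
    split_ifs with h
    · rw [hp, (Nat.even_iff.2 h).neg_one_pow]; exact c1
    · rw [hp, (Nat.odd_iff.2 (by omega : (o + o') % 2 = 1)).neg_one_pow]; exact c2
  obtain ⟨k1, k2⟩ := key _ hN
  exact ⟨fun h => by rw [k1 h], fun h => by rw [k2 h]⟩
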